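/- arXiv:0708.4366 — 2 statements merged into one kernel-verified Lean document; each statement's English description precedes it below -/
import Mathlib

section
/- Assume the Coxeter diagram of (W, S) is connected (W is irreducible) and J ≠ I. Let w ∈ W^J and K = I(J,δ;w). Then there exists a proper δ-stable subset J' ⊊ I with w W_K ⊆ W_{J'} if and only if supp_δ(w) ≠ I. -/
namespace HePaper

variable {I : Type*} {M : CoxeterMatrix I} {W : Type*} [Group W]

/-- The standard parabolic subgroup `W_J` generated by the simple reflections `s_j`, `j ∈ J`. -/
def parabolic (cs : CoxeterSystem M W) (J : Set I) : Subgroup W :=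
  Subgroup.closure (cs.simple '' J)

/-- `W^J`, the set of minimal length coset representatives for `W/W_J`. -/
def minRight (cs : CoxeterSystem M W) (J : Set I) : Set W :=
  {w : W | ∀ j ∈ J, cs.length w < cs.length (w * cs.simple j)}

/-- `^J W`, the set of minimal length coset representatives for `W_J\W`. -/
def minLeft (cs : CoxeterSystem M W) (J : Set I) : Set W :=
  {w : W | ∀ j ∈ J, cs.length w < cs.length (cs.simple j * w)}

/-- `Ad(u)(K) = {k ∈ I : s_k = u s_j u⁻¹ for some j ∈ K}`. -/
def AdSet (cs : CoxeterSystem M W) (u : W) (K : Set I) : Set I :=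
  {k : I | ∃ j ∈ K, cs.simple k = u * cs.simple j * u⁻¹}

/-- Membership in the set `T(J, δ)` of sequences `(J_n, w_n)_{n ≥ 0}`. -/
def InT (cs : CoxeterSystem M W) (J : Set I) (δ : I ≃ I)
    (Jseq : ℕ → Set I) (wseq : ℕ → W) : Prop :=
  Jseq 0 = J ∧
  (∀ n : ℕ, Jseq (n + 1) = Jseq n ∩ AdSet cs (wseq n) (δ '' Jseq n)) ∧
  (∀ n : ℕ, wseq n ∈ minLeft cs (Jseq n) ∩ minRight cs (δ '' Jseq n)) ∧
  (∀ n : ℕ, ∃ x ∈ parabolic cs (Jseq (n + 1)), ∃ y ∈ parabolic cs (δ '' Jseq n),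
      wseq (n + 1) = x * wseq n * y)

/-- `I(J, δ; w)`: the largest subset `K ⊆ J` with `Ad(w)(K) = δ(K)`. -/
def IJdw (cs : CoxeterSystem M W) (J : Set I) (δ : I ≃ I) (w : W) : Set I :=
  ⋃₀ {K : Set I | K ⊆ J ∧ AdSet cs w K = δ '' K}

/-- The orbit of `w` under the `W_J`-action `x · y = δ(x) y x⁻¹`. -/
def orbit (cs : CoxeterSystem M W) (J : Set I) (δW : W ≃* W) (w : W) : Set W :=
  {y : W | ∃ x ∈ parabolic cs J, y = δW x * w * x⁻¹}

/-- The set of elements of minimal length in the orbit of `w`. -/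
def orbitMin (cs : CoxeterSystem M W) (J : Set I) (δW : W ≃* W) (w : W) : Set W :=
  {v ∈ orbit cs J δW w | ∀ u ∈ orbit cs J δW w, cs.length v ≤ cs.length u}

/-- `w →_{s_j} w'` for some `j ∈ J`: `w' = s_{δ(j)} w s_j` and `ℓ(w') ≤ ℓ(w)`. -/
def stepTo (cs : CoxeterSystem M W) (J : Set I) (δ : I ≃ I) (w w' : W) : Prop :=
  ∃ j ∈ J, w' = cs.simple (δ j) * w * cs.simple j ∧ cs.length w' ≤ cs.length w

/-- `w →_{J,δ} w'`. -/
def toRel (cs : CoxeterSystem M W) (J : Set I) (δ : I ≃ I) : W → W → Prop :=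
  Relation.ReflTransGen (stepTo cs J δ)

/-- `w` and `w'` are elementarily strongly `(J, δ)`-conjugate. -/
def ElemStrong (cs : CoxeterSystem M W) (J : Set I) (δW : W ≃* W) (w w' : W) : Prop :=
  cs.length w = cs.length w' ∧
  ∃ x ∈ parabolic cs J, w' = δW x * w * x⁻¹ ∧
    (cs.length (δW x * w) = cs.length x + cs.length w ∨
     cs.length (w * x⁻¹) = cs.length x + cs.length w)

/-- `w ∼_{J,δ} w'`: strongly `(J, δ)`-conjugate. -/
def simRel (cs : CoxeterSystem M W) (J : Set I) (δW : W ≃* W) : W → W → Prop :=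
  Relation.ReflTransGen (ElemStrong cs J δW)

/-- The Bruhat order on `W`: some reduced word for `w` contains a subword that is a
reduced word for `u`. -/
def bruhatLE (cs : CoxeterSystem M W) (u w : W) : Prop :=
  ∃ ω : List I, cs.wordProd ω = w ∧ cs.IsReduced ω ∧
    ∃ ω' : List I, ω'.Sublist ω ∧ cs.wordProd ω' = u ∧ cs.IsReduced ω'

/-- `supp(w)`: the smallest subset `K ⊆ I` with `w ∈ W_K`. -/
def supp (cs : CoxeterSystem M W) (w : W) : Set I :=
  ⋂₀ {K : Set I | w ∈ parabolic cs K}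

/-- `supp_δ(w)`: the smallest `δ`-stable subset of `I` containing `supp(w)`. -/
def suppDelta (cs : CoxeterSystem M W) (δ : I ≃ I) (w : W) : Set I :=
  ⋃ n : ℕ, (⇑δ)^[n] '' supp cs w

/-- `w ≤_{J,δ} w'` for `w, w' ∈ W^J`. -/
def leJd (cs : CoxeterSystem M W) (J : Set I) (δW : W ≃* W) (w w' : W) : Prop :=
  ∀ v' ∈ orbitMin cs J δW w', ∃ v ∈ orbitMin cs J δW w, bruhatLE cs v v'


open CoxeterSystem

/-! ### The geometric representation -/

/-- The entry `-2 cos(π / m)` of the (normalized) Gram matrix of the geometric representation. It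
is `-2` when `m = 0` encodes an infinite order. -/
noncomputable def gram (M : CoxeterMatrix I) (i j : I) : ℝ :=
  -2 * Real.cos (Real.pi / M i j)

theorem gram_self (M : CoxeterMatrix I) (i : I) : gram M i i = 2 := by
  simp [gram]

theorem gram_comm (M : CoxeterMatrix I) (i j : I) : gram M i j = gram M j i := by
  simp [gram, M.symmetric i j]

theorem gram_eq_zero_of_eq_two {i j : I} (h : M i j = 2) : gram M i j = 0 := by
  simp [gram, h]

theorem eq_two_of_gram_eq_zero {i j : I} (h : gram M i j = 0) : M i j = 2 := by
  have hcos : Real.cos (Real.pi / M i j) = 0 := by simpa [gram] using h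
  by_contra hne
  rcases Nat.lt_or_ge (M i j) 2 with hlt | hge
  · interval_cases hm : M i j <;> simp at hcos
  · have h3 : (3 : ℝ) ≤ M i j := by exact_mod_cast (by omega : 3 ≤ M i j)
    refine (Real.cos_pos_of_mem_Ioo ⟨?_, ?_⟩).ne' hcos
    · have : 0 ≤ Real.pi / M i j := by positivity
      linarith [Real.pi_pos]
    · exact div_lt_div_of_pos_left Real.pi_pos (by norm_num) (by linarith)

/-- The functional `x ↦ ⟨e_i^∨, x⟩` of the geometric representation. -/
noncomputable def coroot (M : CoxeterMatrix I) (i : I) : Module.Dual ℝ (I →₀ ℝ) :=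
  Finsupp.linearCombination ℝ (gram M i)

theorem coroot_single (M : CoxeterMatrix I) (i j : I) :
    coroot M i (Finsupp.single j 1) = gram M i j := by
  simp [coroot]

theorem coroot_single_self (M : CoxeterMatrix I) (i : I) :
    coroot M i (Finsupp.single i 1) = 2 := by
  rw [coroot_single, gram_self]

/-- The reflection by which the simple generator `s_i` acts on the geometric representation. -/
noncomputable def geomReflection (M : CoxeterMatrix I) (i : I) : (I →₀ ℝ) ≃ₗ[ℝ] (I →₀ ℝ) :=
  Module.reflection (coroot_single_self M i)

theorem geomReflection_apply (M : CoxeterMatrix I) (i : I) (x : I →₀ ℝ) :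
    geomReflection M i x = x - coroot M i x • Finsupp.single i 1 :=
  Module.reflection_apply x (coroot_single_self M i)

theorem geomReflection_mul_self (M : CoxeterMatrix I) (i : I) :
    geomReflection M i * geomReflection M i = 1 := by
  ext1 x
  exact Module.involutive_reflection (coroot_single_self M i) x

open Polynomial.Chebyshev in
/-- The vanishing of the Chebyshev coefficients in `(r₁ r₂) ^ m - 1`, where `r₁ r₂` is a rotation
of angle `2π/m`. -/
theorem chebyshev_coeff_eq_zero {m : ℕ} (hm : 3 ≤ m) (t : ℝ)
    (ht : t = 2 * Real.cos (2 * Real.pi / m)) :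
    (S ℝ (((m : ℤ) - 2) / 2)).eval t *
        ((S ℝ (((m : ℤ) - 1) / 2)).eval t + (S ℝ (((m : ℤ) - 3) / 2)).eval t) = 0 ∧
      (S ℝ (((m : ℤ) - 1) / 2)).eval t *
        ((S ℝ ((m : ℤ) / 2)).eval t + (S ℝ (((m : ℤ) - 2) / 2)).eval t) = 0 := by
  set θ := 2 * Real.pi / m with hθ
  have hm3 : (3 : ℝ) ≤ m := by exact_mod_cast hm
  have hmθ : m * θ = 2 * Real.pi := by rw [hθ]; field_simp
  have hsin : Real.sin θ ≠ 0 := by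
    refine (Real.sin_pos_of_pos_of_lt_pi (by positivity) ?_).ne'
    nlinarith [Real.pi_pos]
  have hS : ∀ n : ℤ, (S ℝ n).eval t * Real.sin θ = Real.sin ((n + 1) * θ) := fun n ↦ by
    rw [ht, S_two_mul_real_cos]
  rcases Nat.even_or_odd' m with ⟨p, hp | hp⟩
  · have hpθ : p * θ = Real.pi := by
      rw [hp] at hmθ; push_cast at hmθ; linarith
    have h0 : (S ℝ ((p : ℤ) - 1)).eval t = 0 := by
      have := hS (p - 1)
      push_cast at this
      rw [sub_add_cancel, hpθ, Real.sin_pi] at this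
      exact (mul_eq_zero.mp this).resolve_right hsin
    rw [show ((m : ℤ) - 2) / 2 = p - 1 by omega, show ((m : ℤ) - 1) / 2 = p - 1 by omega, h0]
    simp
  · have hpθ : (p + 1) * θ = 2 * Real.pi - p * θ := by
      rw [hp] at hmθ; push_cast at hmθ; linarith
    have h0 : (S ℝ (p : ℤ)).eval t + (S ℝ ((p : ℤ) - 1)).eval t = 0 := by
      have h1 := hS p
      have h2 := hS (p - 1)
      push_cast at h1 h2
      rw [hpθ, Real.sin_two_pi_sub] at h1
      rw [sub_add_cancel] at h2
      refine (mul_eq_zero.mp (?_ : _ * Real.sin θ = 0)).resolve_right hsin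
      linarith
    rw [show ((m : ℤ) - 2) / 2 = p - 1 by omega, show ((m : ℤ) - 1) / 2 = p by omega,
      show ((m : ℤ) - 3) / 2 = p - 1 by omega, show (m : ℤ) / 2 = p by omega, h0]
    simp

theorem isLiftable_geomReflection (M : CoxeterMatrix I) : M.IsLiftable (geomReflection M) := by
  intro i j
  rcases eq_or_ne i j with rfl | hij
  · simp [geomReflection_mul_self]
  rcases Nat.lt_or_ge (M i j) 3 with hlt | hge
  · interval_cases hm : M i j
    · simp
    · exact absurd hm (M.off_diagonal i j hij)
    · have hi := gram_eq_zero_of_eq_two hm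
      have hj := hi
      rw [gram_comm] at hj
      have hcomm : geomReflection M i * geomReflection M j =
          geomReflection M j * geomReflection M i := by
        ext1 x
        simp only [LinearEquiv.mul_apply, geomReflection_apply, map_sub, map_smul, coroot_single,
          hi, hj, zero_smul, sub_zero]
        abel
      rw [pow_two]
      nth_rw 1 [hcomm]
      rw [mul_assoc, ← mul_assoc (geomReflection M i), geomReflection_mul_self, one_mul,
        geomReflection_mul_self]
  · ext1 x
    have ht : coroot M i (Finsupp.single j 1) * coroot M j (Finsupp.single i 1) - 2 =
        2 * Real.cos (2 * Real.pi / M i j) := by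
      rw [coroot_single, coroot_single, gram_comm M j i, gram, mul_div_assoc, Real.cos_two_mul]
      ring
    obtain ⟨h1, h2⟩ := chebyshev_coeff_eq_zero hge _ ht
    rw [geomReflection, geomReflection,
      Module.reflection_mul_reflection_pow_apply (coroot_single_self M i)
        (coroot_single_self M j) (M i j) x, h1, h2]
    simp

/-- The geometric representation of a Coxeter group. -/
noncomputable def geomRep (cs : CoxeterSystem M W) : W →* ((I →₀ ℝ) ≃ₗ[ℝ] (I →₀ ℝ)) :=
  cs.lift ⟨geomReflection M, isLiftable_geomReflection M⟩

theorem geomRep_simple_apply (cs : CoxeterSystem M W) (i : I) (x : I →₀ ℝ) :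
    geomRep cs (cs.simple i) x = x - coroot M i x • Finsupp.single i 1 := by
  rw [geomRep, lift_apply_simple, geomReflection_apply]

theorem geomRep_simple_apply_of_ne (cs : CoxeterSystem M W) {i k : I} (h : i ≠ k) (x : I →₀ ℝ) :
    geomRep cs (cs.simple i) x k = x k := by
  simp [geomRep_simple_apply, Finsupp.single_eq_of_ne h.symm]

/-! ### Parabolic subgroups and the geometric representation -/

theorem simple_mem_parabolic (cs : CoxeterSystem M W) {A : Set I} {i : I} (hi : i ∈ A) :
    cs.simple i ∈ parabolic cs A :=
  Subgroup.subset_closure (Set.mem_image_of_mem _ hi)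

theorem parabolic_mono (cs : CoxeterSystem M W) {A B : Set I} (h : A ⊆ B) :
    parabolic cs A ≤ parabolic cs B :=
  Subgroup.closure_mono (Set.image_mono h)

theorem wordProd_mem_parabolic (cs : CoxeterSystem M W) {A : Set I} {ω : List I}
    (h : ∀ i ∈ ω, i ∈ A) : cs.wordProd ω ∈ parabolic cs A := by
  refine Subgroup.list_prod_mem _ fun x hx ↦ ?_
  obtain ⟨i, hi, rfl⟩ := List.mem_map.mp hx
  exact simple_mem_parabolic cs (h i hi)

theorem exists_word_of_mem_parabolic (cs : CoxeterSystem M W) {A : Set I} {w : W}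
    (hw : w ∈ parabolic cs A) : ∃ ω : List I, (∀ i ∈ ω, i ∈ A) ∧ cs.wordProd ω = w := by
  induction hw using Subgroup.closure_induction with
  | mem x hx =>
    obtain ⟨i, hi, rfl⟩ := hx
    exact ⟨[i], by simpa using hi, by simp⟩
  | one => exact ⟨[], by simp, by simp⟩
  | mul x y _ _ hx hy =>
    obtain ⟨ω, h, rfl⟩ := hx
    obtain ⟨ω', h', rfl⟩ := hy
    refine ⟨ω ++ ω', fun i hi ↦ ?_, cs.wordProd_append ω ω'⟩
    exact (List.mem_append.mp hi).elim (h i) (h' i)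
  | inv x _ hx =>
    obtain ⟨ω, h, rfl⟩ := hx
    exact ⟨ω.reverse, fun i hi ↦ h i (List.mem_reverse.mp hi), cs.wordProd_reverse ω⟩

theorem geomRep_apply_of_mem_parabolic (cs : CoxeterSystem M W) {A : Set I} {k : I} (hk : k ∉ A)
    {w : W} (hw : w ∈ parabolic cs A) (x : I →₀ ℝ) : geomRep cs w x k = x k := by
  obtain ⟨ω, h, rfl⟩ := exists_word_of_mem_parabolic cs hw
  induction ω with
  | nil => simp
  | cons i ω ih =>
    rw [List.forall_mem_cons] at h
    rw [wordProd_cons, map_mul, LinearEquiv.mul_apply,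
      geomRep_simple_apply_of_ne cs (ne_of_mem_of_not_mem h.1 hk),
      ih h.2 (wordProd_mem_parabolic cs h.2)]

theorem mem_of_simple_mem_parabolic (cs : CoxeterSystem M W) {A : Set I} {k : I}
    (h : cs.simple k ∈ parabolic cs A) : k ∈ A := by
  by_contra hk
  have := geomRep_apply_of_mem_parabolic cs hk h (Finsupp.single k 1)
  rw [geomRep_simple_apply, coroot_single_self] at this
  norm_num at this

theorem eq_of_simple_eq_conj (cs : CoxeterSystem M W) {A : Set I} {w : W}
    (hw : w ∈ parabolic cs A) {j k : I} (hj : j ∉ A)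
    (h : cs.simple k = w * cs.simple j * w⁻¹) : k = j := by
  by_contra hkj
  have h' : cs.simple k * w = w * cs.simple j := by rw [h]; group
  have := congrArg (fun v ↦ geomRep cs v (Finsupp.single j 1) j) h'
  simp only [map_mul, LinearEquiv.mul_apply] at this
  rw [geomRep_simple_apply_of_ne cs hkj, geomRep_apply_of_mem_parabolic cs hj hw,
    geomRep_apply_of_mem_parabolic cs hj hw, geomRep_simple_apply, coroot_single_self] at this
  norm_num at this

theorem eq_two_of_conj_simple_mem_parabolic (cs : CoxeterSystem M W) {A : Set I} {i k : I}
    (hi : i ∈ A) (hk : k ∉ A)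
    (h : cs.simple k * cs.simple i * cs.simple k ∈ parabolic cs A) : M i k = 2 := by
  have hik : i ≠ k := fun e ↦ hk (e ▸ hi)
  have := geomRep_apply_of_mem_parabolic cs hk h (Finsupp.single k 1)
  simp only [map_mul, LinearEquiv.mul_apply, geomRep_simple_apply, map_sub, map_smul,
    coroot_single, gram_self, gram_comm M k i] at this
  simp [Finsupp.single_eq_of_ne hik.symm] at this
  apply eq_two_of_gram_eq_zero
  have h2 : gram M i k * gram M i k = 0 := by linarith
  exact mul_self_eq_zero.mp h2

/-! ### The exchange condition -/

open Classical in
/-- The map by which `s_i` acts on `W × ℤ/2` in the parity-counting action of a Coxeter group. -/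
noncomputable def parityStep (cs : CoxeterSystem M W) (i : I) : Function.End (W × ZMod 2) :=
  fun p ↦ (cs.simple i * p.1 * cs.simple i, p.2 + if p.1 = cs.simple i then 1 else 0)

open Classical in
theorem parityStep_mul_pow_apply (cs : CoxeterSystem M W) (i j : I) (n : ℕ) (p : W × ZMod 2) :
    ((parityStep cs i * parityStep cs j) ^ n) p =
      ((cs.simple i * cs.simple j) ^ n * p.1 * (cs.simple j * cs.simple i) ^ n,
        p.2 + ∑ k ∈ Finset.range (2 * n),
          if p.1 = (cs.simple j * cs.simple i) ^ k * cs.simple j then 1 else 0) := by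
  have hinv : ∀ n : ℕ, ((cs.simple i * cs.simple j) ^ n)⁻¹ = (cs.simple j * cs.simple i) ^ n :=
    fun n ↦ by rw [← inv_pow]; simp
  have hcomm : ∀ n : ℕ, cs.simple j * (cs.simple i * cs.simple j) ^ n =
      (cs.simple j * cs.simple i) ^ n * cs.simple j := fun n ↦ by
    induction n with
    | zero => simp
    | succ n ih => rw [pow_succ, ← mul_assoc, ih, pow_succ]; simp only [mul_assoc]
  have hconj : ∀ (n : ℕ) (t u : W),
      (cs.simple i * cs.simple j) ^ n * t * (cs.simple j * cs.simple i) ^ n = u ↔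
        t = (cs.simple j * cs.simple i) ^ n * u * (cs.simple i * cs.simple j) ^ n := by
    intro n t u
    rw [← hinv, mul_inv_eq_iff_eq_mul, ← eq_inv_mul_iff_mul_eq, mul_assoc]
  induction n with
  | zero => simpa using Function.End.one_def ▸ rfl
  | succ n ih =>
    rw [pow_succ', show ((parityStep cs i * parityStep cs j) *
      (parityStep cs i * parityStep cs j) ^ n) p = parityStep cs i (parityStep cs j
        (((parityStep cs i * parityStep cs j) ^ n) p)) from rfl, ih]
    have e1 : (cs.simple i * cs.simple j) ^ n * p.1 * (cs.simple j * cs.simple i) ^ n =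
        cs.simple j ↔ p.1 = (cs.simple j * cs.simple i) ^ (2 * n) * cs.simple j := by
      rw [hconj, mul_assoc, hcomm, ← mul_assoc, ← pow_add, two_mul]
    have e2 : cs.simple j * ((cs.simple i * cs.simple j) ^ n * p.1 *
        (cs.simple j * cs.simple i) ^ n) * cs.simple j = cs.simple i ↔
        p.1 = (cs.simple j * cs.simple i) ^ (2 * n + 1) * cs.simple j := by
      have : (cs.simple j * cs.simple i) ^ (2 * n + 1) * cs.simple j =
          (cs.simple j * cs.simple i) ^ n * (cs.simple j * cs.simple i * cs.simple j) *
            (cs.simple i * cs.simple j) ^ n := by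
        rw [mul_assoc, mul_assoc _ (cs.simple j), hcomm, ← mul_assoc, ← mul_assoc, ← pow_succ,
          ← pow_add]
        congr 2
        omega
      rw [this, ← hconj]
      generalize (cs.simple i * cs.simple j) ^ n * p.1 * (cs.simple j * cs.simple i) ^ n = u
      constructor <;> intro h
      · rw [← h]
        simp [mul_assoc]
      · rw [h]
        simp [mul_assoc]
    simp only [parityStep, e1, e2]
    rw [show 2 * (n + 1) = 2 * n + 1 + 1 by ring, Finset.sum_range_succ, Finset.sum_range_succ,
      pow_succ' _ n, pow_succ _ n]
    simp only [mul_assoc, add_assoc]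

theorem isLiftable_parityStep (cs : CoxeterSystem M W) : M.IsLiftable (parityStep cs) := by
  classical
  intro i j
  funext p
  rw [parityStep_mul_pow_apply, two_mul, Finset.sum_range_add]
  simp only [pow_add, simple_mul_simple_pow, simple_mul_simple_pow', one_mul, mul_one]
  rw [CharTwo.add_self_eq_zero, add_zero]
  rfl

/-- The parity-counting action of a Coxeter group on `W × ℤ/2`. -/
noncomputable def parityAction (cs : CoxeterSystem M W) : W →* Function.End (W × ZMod 2) :=
  cs.lift ⟨parityStep cs, isLiftable_parityStep cs⟩

open Classical in
theorem parityAction_wordProd (cs : CoxeterSystem M W) (ω : List I) (p : W × ZMod 2) :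
    parityAction cs (cs.wordProd ω) p =
      (cs.wordProd ω * p.1 * (cs.wordProd ω)⁻¹, p.2 + ((cs.rightInvSeq ω).count p.1 : ℕ)) := by
  induction ω with
  | nil =>
    rw [wordProd_nil, map_one, rightInvSeq_nil]
    simpa using Function.End.one_def ▸ rfl
  | cons i ω ih =>
    rw [wordProd_cons, map_mul, show (parityAction cs (cs.simple i) *
      parityAction cs (cs.wordProd ω)) p = parityAction cs (cs.simple i)
        (parityAction cs (cs.wordProd ω) p) from rfl, ih, parityAction, lift_apply_simple,
      parityStep, rightInvSeq, List.count_cons]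
    have e : cs.wordProd ω * p.1 * (cs.wordProd ω)⁻¹ = cs.simple i ↔
        (cs.wordProd ω)⁻¹ * cs.simple i * cs.wordProd ω = p.1 := by
      rw [mul_inv_eq_iff_eq_mul, ← eq_inv_mul_iff_mul_eq, mul_assoc, eq_comm]
    ext
    · simp [mul_assoc]
    · simp only [e, beq_iff_eq]
      split_ifs <;> simp [add_assoc]

/-- The exchange condition for right descents. -/
theorem exists_mul_simple_eq_wordProd_eraseIdx (cs : CoxeterSystem M W) (ω : List I) {i : I}
    (h : cs.IsRightDescent (cs.wordProd ω) i) :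
    ∃ j < ω.length, cs.wordProd ω * cs.simple i = cs.wordProd (ω.eraseIdx j) := by
  classical
  obtain ⟨ω', hω', hprod⟩ := cs.exists_isReduced (cs.wordProd ω * cs.simple i)
  have hconcat : cs.wordProd (ω'.concat i) = cs.wordProd ω := by
    rw [wordProd_concat, ← hprod, simple_mul_simple_cancel_right]
  have hred : cs.IsReduced (ω'.concat i) := by
    have h1 := cs.isRightDescent_iff.mp h
    have h2 := hω'.eq
    rw [← hprod] at h2
    rw [CoxeterSystem.IsReduced, hconcat, List.length_concat]
    omega
  have hcount : (cs.rightInvSeq (ω'.concat i)).count (cs.simple i) = 1 :=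
    List.count_eq_one_of_mem hred.nodup_rightInvSeq (by rw [rightInvSeq_concat]; simp)
  have hpar := parityAction_wordProd cs ω (cs.simple i, 0)
  rw [← hconcat, parityAction_wordProd, hcount, Prod.mk.injEq] at hpar
  have hmem : cs.simple i ∈ cs.rightInvSeq ω := by
    by_contra hn
    rw [List.count_eq_zero_of_not_mem hn] at hpar
    simp at hpar
  obtain ⟨j, hj, hji⟩ := List.mem_iff_getElem.mp hmem
  refine ⟨j, by simpa using hj, ?_⟩
  rw [← wordProd_mul_getD_rightInvSeq, List.getD_eq_getElem _ _ hj, hji]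

/-- The exchange condition for left descents. -/
theorem exists_simple_mul_eq_wordProd_eraseIdx (cs : CoxeterSystem M W) (ω : List I) {i : I}
    (h : cs.IsLeftDescent (cs.wordProd ω) i) :
    ∃ j < ω.length, cs.simple i * cs.wordProd ω = cs.wordProd (ω.eraseIdx j) := by
  rw [← isRightDescent_inv_iff, ← wordProd_reverse] at h
  obtain ⟨j, hj, hprod⟩ := exists_mul_simple_eq_wordProd_eraseIdx cs ω.reverse h
  rw [List.length_reverse] at hj
  refine ⟨ω.length - 1 - j, by omega, ?_⟩
  apply inv_injective
  rw [mul_inv_rev, inv_simple, ← wordProd_reverse, hprod, ← wordProd_reverse]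
  congr 1
  apply List.ext_getElem <;> grind

/-! ### Supports -/

theorem mem_of_isReduced_of_mem_parabolic (cs : CoxeterSystem M W) {A : Set I} {ω : List I}
    (hω : cs.IsReduced ω) (h : cs.wordProd ω ∈ parabolic cs A) : ∀ i ∈ ω, i ∈ A := by
  induction ω with
  | nil => simp
  | cons i ω ih =>
    have htail : cs.IsReduced ω := by simpa using hω.drop 1
    have hdesc : cs.IsLeftDescent (cs.wordProd (i :: ω)) i := by
      rw [IsLeftDescent, hω.eq, wordProd_cons, simple_mul_simple_cancel_left, htail.eq]
      simp
    obtain ⟨ω', hA, hprod⟩ := exists_word_of_mem_parabolic cs h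
    rw [← hprod] at hdesc
    obtain ⟨j, -, hj⟩ := exists_simple_mul_eq_wordProd_eraseIdx cs ω' hdesc
    have hmem : cs.simple i * cs.wordProd (i :: ω) ∈ parabolic cs A := by
      rw [← hprod, hj]
      exact wordProd_mem_parabolic cs fun k hk ↦ hA k (List.mem_of_mem_eraseIdx hk)
    have hi : i ∈ A :=
      mem_of_simple_mem_parabolic cs ((Subgroup.mul_mem_cancel_right _ h).mp hmem)
    rw [wordProd_cons, simple_mul_simple_cancel_left] at hmem
    exact List.forall_mem_cons.mpr ⟨hi, ih htail hmem⟩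

theorem supp_subset_of_mem_parabolic (cs : CoxeterSystem M W) {A : Set I} {w : W}
    (h : w ∈ parabolic cs A) : supp cs w ⊆ A :=
  Set.sInter_subset_of_mem h

theorem mem_parabolic_supp (cs : CoxeterSystem M W) (w : W) : w ∈ parabolic cs (supp cs w) := by
  obtain ⟨ω, hω, rfl⟩ := cs.exists_isReduced w
  exact wordProd_mem_parabolic cs fun i hi A hA ↦ mem_of_isReduced_of_mem_parabolic cs hω hA i hi

theorem eq_two_of_commute_of_isReduced (cs : CoxeterSystem M W) {A : Set I} {k : I} (hk : k ∉ A)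
    {ω : List I} (hω : cs.IsReduced ω) (hA : ∀ i ∈ ω, i ∈ A)
    (hcomm : Commute (cs.simple k) (cs.wordProd ω)) : ∀ i ∈ ω, M i k = 2 := by
  induction ω with
  | nil => simp
  | cons i ω ih =>
    have htail : cs.IsReduced ω := by simpa using hω.drop 1
    have hmem := wordProd_mem_parabolic cs hA
    rw [List.forall_mem_cons] at hA
    have hsi := simple_mem_parabolic cs hA.1
    have hkA : cs.simple k ∉ parabolic cs A := fun h ↦ hk (mem_of_simple_mem_parabolic cs h)
    have hlen : cs.length (cs.simple k * cs.wordProd (i :: ω)) = ω.length + 2 := by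
      rcases cs.length_simple_mul (cs.wordProd (i :: ω)) k with h | h
      · rw [h, hω.eq, List.length_cons]
      · obtain ⟨j, -, hj⟩ := exists_simple_mul_eq_wordProd_eraseIdx cs (i :: ω)
          (cs.isLeftDescent_iff.mpr h)
        refine absurd ?_ hkA
        rw [← Subgroup.mul_mem_cancel_right _ hmem, hj]
        exact wordProd_mem_parabolic cs fun l hl ↦
          List.forall_mem_cons.mpr hA l (List.mem_of_mem_eraseIdx hl)
    have hdesc : cs.IsLeftDescent (cs.wordProd (k :: i :: ω)) i := by
      rw [IsLeftDescent, wordProd_cons, hlen, hcomm.eq, wordProd_cons, mul_assoc,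
        simple_mul_simple_cancel_left]
      have := cs.length_mul_le (cs.wordProd ω) (cs.simple k)
      rw [length_simple, htail.eq] at this
      omega
    obtain ⟨j, -, hj⟩ := exists_simple_mul_eq_wordProd_eraseIdx cs (k :: i :: ω) hdesc
    have hM : M i k = 2 := by
      rcases j with _ | j
      · refine absurd ?_ hkA
        rw [List.eraseIdx_cons_zero, wordProd_cons] at hj
        rw [← Subgroup.mul_mem_cancel_right _ hmem, ← Subgroup.mul_mem_cancel_left _ hsi, hj]
        exact hmem
      · rw [List.eraseIdx_cons_succ, wordProd_cons, wordProd_cons] at hj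
        apply eq_two_of_conj_simple_mem_parabolic cs hA.1 hk
        have : cs.simple k * cs.simple i * cs.simple k * cs.wordProd (i :: ω) =
            cs.wordProd ((i :: ω).eraseIdx j) := by
          rw [mul_assoc, mul_assoc, wordProd_cons, hj, wordProd_cons, simple_mul_simple_cancel_left]
        rw [← Subgroup.mul_mem_cancel_right _ hmem, this]
        exact wordProd_mem_parabolic cs fun l hl ↦
          List.forall_mem_cons.mpr hA l (List.mem_of_mem_eraseIdx hl)
    have hki : Commute (cs.simple k) (cs.simple i) := by
      have h2 := cs.simple_mul_simple_pow' i k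
      rw [hM, pow_two] at h2
      have h3 := eq_inv_of_mul_eq_one_left h2
      rwa [mul_inv_rev, inv_simple, inv_simple] at h3
    refine List.forall_mem_cons.mpr ⟨hM, ih htail hA.2 ?_⟩
    have := hki.mul_right hcomm
    rwa [wordProd_cons, simple_mul_simple_cancel_left] at this

theorem eq_two_of_commute_of_mem_supp (cs : CoxeterSystem M W) {k i : I} {w : W}
    (hk : k ∉ supp cs w) (hcomm : Commute (cs.simple k) w) (hi : i ∈ supp cs w) : M i k = 2 := by
  obtain ⟨ω, hω, rfl⟩ := cs.exists_isReduced w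
  refine eq_two_of_commute_of_isReduced cs hk hω ?_ hcomm i ?_
  · exact mem_of_isReduced_of_mem_parabolic cs hω (mem_parabolic_supp cs _)
  · exact supp_subset_of_mem_parabolic cs
      (wordProd_mem_parabolic (A := {i | i ∈ ω}) cs fun _ h ↦ h) hi

theorem supp_subset_suppDelta (cs : CoxeterSystem M W) (δ : I ≃ I) (w : W) :
    supp cs w ⊆ suppDelta cs δ w := fun i hi ↦
  Set.mem_iUnion.mpr ⟨0, i, hi, rfl⟩

theorem image_eq_self_of_subset [Finite I] (δ : I ≃ I) {A : Set I} (h : δ '' A ⊆ A) :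
    δ '' A = A :=
  Set.eq_of_subset_of_ncard_le h (Set.ncard_image_of_injective A δ.injective).ge

theorem image_suppDelta [Finite I] (cs : CoxeterSystem M W) (δ : I ≃ I) (w : W) :
    δ '' suppDelta cs δ w = suppDelta cs δ w := by
  refine image_eq_self_of_subset δ ?_
  rintro _ ⟨i, hi, rfl⟩
  obtain ⟨n, j, hj, rfl⟩ := Set.mem_iUnion.mp hi
  exact Set.mem_iUnion.mpr ⟨n + 1, j, hj, Function.iterate_succ_apply' δ n j⟩

theorem suppDelta_subset (cs : CoxeterSystem M W) {δ : I ≃ I} {w : W} {A : Set I}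
    (hA : δ '' A = A) (hw : w ∈ parabolic cs A) : suppDelta cs δ w ⊆ A := by
  refine Set.iUnion_subset fun n ↦ ?_
  rintro _ ⟨i, hi, rfl⟩
  exact (Set.mapsTo_iff_image_subset.mpr hA.subset).iterate n (supp_subset_of_mem_parabolic cs hw hi)

theorem IJdw_subset (cs : CoxeterSystem M W) (J : Set I) (δ : I ≃ I) (w : W) :
    IJdw cs J δ w ⊆ J :=
  Set.sUnion_subset fun _ h ↦ h.1

theorem adSet_IJdw (cs : CoxeterSystem M W) (J : Set I) (δ : I ≃ I) (w : W) :
    AdSet cs w (IJdw cs J δ w) = δ '' IJdw cs J δ w := by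
  ext k
  constructor
  · rintro ⟨j, ⟨K, hK, hj⟩, h⟩
    exact Set.image_mono (Set.subset_sUnion_of_mem hK) (hK.2 ▸ ⟨j, hj, h⟩)
  · rintro ⟨j, ⟨K, hK, hj⟩, rfl⟩
    have hmem : δ j ∈ AdSet cs w K := hK.2 ▸ Set.mem_image_of_mem δ hj
    obtain ⟨l, hl, h⟩ := hmem
    exact ⟨l, ⟨K, hK, hl⟩, h⟩

/-- for irreducible `W` and `J ≠ I`, `w W_K ⊆ W_{J'}` for some proper
`δ`-stable `J' ⊊ I` iff `supp_δ(w) ≠ I`, where `K = I(J,δ;w)`. -/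
theorem proper_delta_stable_iff_supp_ne_univ
    [Fintype I] [Finite W]
    (cs : CoxeterSystem M W)
    (hconn : ∀ A : Set I, A.Nonempty → Aᶜ.Nonempty → ∃ i ∈ A, ∃ j ∈ Aᶜ, M i j ≠ 2)
    (J : Set I) (hJ : J ≠ Set.univ) (δ : I ≃ I)
    (hδM : ∀ i j : I, M (δ i) (δ j) = M i j)
    (w : W) (hw : w ∈ minRight cs J) :
    (∃ J' : Set I, J' ≠ Set.univ ∧ δ '' J' = J' ∧
        ∀ v ∈ parabolic cs (IJdw cs J δ w), w * v ∈ parabolic cs J') ↔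
      suppDelta cs δ w ≠ Set.univ := by
  set A := suppDelta cs δ w
  set K := IJdw cs J δ w
  have hδA : δ '' A = A := image_suppDelta cs δ w
  have hwA : w ∈ parabolic cs A :=
    parabolic_mono cs (supp_subset_suppDelta cs δ w) (mem_parabolic_supp cs w)
  constructor
  · rintro ⟨J', hne, hδ, hJ'⟩ huniv
    have hwJ' : w ∈ parabolic cs J' := by simpa using hJ' 1 (one_mem _)
    exact hne (Set.univ_subset_iff.mp (huniv ▸ suppDelta_subset cs hδ hwJ'))
  · intro hA
    have hconj : ∀ k ∈ δ '' K, k ∉ A → k ∈ K ∧ cs.simple k = w * cs.simple k * w⁻¹ := by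
      intro k hk hkA
      rw [← adSet_IJdw] at hk
      obtain ⟨j, hj, h⟩ := hk
      have hjA : j ∉ A := fun hjA ↦ hkA <| mem_of_simple_mem_parabolic cs <| h ▸
        mul_mem (mul_mem hwA (simple_mem_parabolic cs hjA)) (inv_mem hwA)
      obtain rfl := eq_of_simple_eq_conj cs hwA hjA h
      exact ⟨hj, h⟩
    have hδB : δ '' (K \ A) = K \ A := by
      refine image_eq_self_of_subset δ fun k hk ↦ ?_
      rw [Set.image_sdiff δ.injective, hδA] at hk
      exact ⟨(hconj k hk.1 hk.2).1, hk.2⟩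
    have hcommB : ∀ k ∈ K \ A, Commute (cs.simple k) w := by
      intro k hk
      rw [← hδB, Set.image_sdiff δ.injective, hδA] at hk
      exact eq_mul_inv_iff_mul_eq.mp (hconj k hk.1 hk.2).2
    have hM : ∀ i ∈ A, ∀ j ∈ K \ A, M i j = 2 := by
      intro i hi j hj
      obtain ⟨n, i, hi', rfl⟩ := Set.mem_iUnion.mp hi
      clear hi
      induction n generalizing j with
      | zero =>
        exact eq_two_of_commute_of_mem_supp cs
          (fun h ↦ hj.2 (supp_subset_suppDelta cs δ w h)) (hcommB j hj) hi'
      | succ n ih =>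
        rw [← hδB] at hj
        obtain ⟨j, hj, rfl⟩ := hj
        rw [Function.iterate_succ_apply', hδM]
        exact ih j hj
    refine ⟨A ∪ K \ A, fun huniv ↦ ?_, by rw [Set.image_union, hδA, hδB], fun v hv ↦ ?_⟩
    · rcases A.eq_empty_or_nonempty with hemp | hne
      · rw [hemp, Set.sdiff_empty, Set.empty_union] at huniv
        exact hJ (Set.univ_subset_iff.mp (huniv ▸ IJdw_subset cs J δ w))
      · obtain ⟨i, hi, j, hj, hij⟩ := hconn A hne (Set.nonempty_compl.mpr hA)
        exact hij (hM i hi j ((huniv ▸ Set.mem_univ j : j ∈ A ∪ K \ A).resolve_left hj))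
    · rw [Set.union_sdiff_self]
      exact mul_mem (parabolic_mono cs Set.subset_union_left hwA)
        (parabolic_mono cs Set.subset_union_right hv)

end HePaper
end

section
/- Let w ∈ W and i ∈ I with i ∉ supp(w). If w s_i w⁻¹ = s_k for some k ∈ I, then k = i; in particular, w then commutes with s_i. -/
namespace HePaper

variable {I : Type*} {M : CoxeterMatrix I} {W : Type*} [Group W]

open Polynomial.Chebyshev in
/-- The product of two reflections with Cartan numbers `-2 cos (π / m)` has order dividing `m`. -/
theorem reflection_mul_reflection_pow_eq_one {V : Type*} [AddCommGroup V] [Module ℝ V]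
    {x y : V} {f g : Module.Dual ℝ V} (hf : f x = 2) (hg : g y = 2) {m : ℕ} (hm : m ≠ 1)
    (hfy : f y = -2 * Real.cos (Real.pi / m)) (hgx : g x = -2 * Real.cos (Real.pi / m)) :
    (Module.reflection hf * Module.reflection hg) ^ m = 1 := by
  rcases eq_or_ne m 0 with rfl | hm₀
  · simp
  rcases eq_or_ne m 2 with rfl | hm₂
  · have hfy' : f y = 0 := by simpa using hfy
    have hgx' : g x = 0 := by simpa using hgx
    ext z
    simp [pow_two, Module.reflection_apply, hf, hg, hfy', hgx']
    module
  have hm₃ : (3 : ℝ) ≤ m := by exact_mod_cast (by omega : 3 ≤ m)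
  set θ : ℝ := 2 * Real.pi / m with hθ
  have hmθ : m * θ = 2 * Real.pi := by rw [hθ]; field_simp
  have hsin : Real.sin θ ≠ 0 := by
    refine (Real.sin_pos_of_pos_of_lt_pi (by positivity) ?_).ne'
    rw [hθ, div_lt_iff₀ (by positivity)]
    nlinarith [Real.pi_pos]
  have ht : 2 * Real.cos θ = f y * g x - 2 := by
    rw [hfy, hgx, hθ, mul_div_assoc, Real.cos_two_mul]
    ring
  have hS : ∀ n : ℤ, (S ℝ n).eval (2 * Real.cos θ) = Real.sin ((n + 1) * θ) / Real.sin θ :=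
    fun n ↦ by rw [eq_div_iff hsin, S_two_mul_real_cos]
  ext z
  rw [Module.reflection_mul_reflection_pow_apply hf hg m z _ ht]
  rcases Nat.even_or_odd' m with ⟨k, rfl | rfl⟩
  · have hk : (S ℝ (k - 1 : ℤ)).eval (2 * Real.cos θ) = 0 := by
      have : (k : ℝ) * θ = Real.pi := by push_cast at hmθ; linarith
      simp [hS, this]
    rw [show ((2 * k : ℕ) - 2 : ℤ) / 2 = k - 1 by omega,
      show ((2 * k : ℕ) - 1 : ℤ) / 2 = k - 1 by omega, hk]
    simp
  · have hk : (S ℝ (k : ℤ)).eval (2 * Real.cos θ) + 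
        (S ℝ (k - 1 : ℤ)).eval (2 * Real.cos θ) = 0 := by
      have : ((k : ℝ) + 1) * θ = 2 * Real.pi - k * θ := by push_cast at hmθ; linarith
      simp [hS, this, Real.sin_two_pi_sub, neg_div]
    rw [show ((2 * k + 1 : ℕ) - 1 : ℤ) / 2 = k by omega,
      show ((2 * k + 1 : ℕ) - 3 : ℤ) / 2 = k - 1 by omega,
      show ((2 * k + 1 : ℕ) : ℤ) / 2 = k by omega,
      show ((2 * k + 1 : ℕ) - 2 : ℤ) / 2 = k - 1 by omega, hk]
    simp

/-- The simple coroot of index `i`, as a linear form on the real space with basis the simple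
roots. -/
noncomputable def simpleCoroot (M : CoxeterMatrix I) (i : I) : Module.Dual ℝ (I →₀ ℝ) :=
  Finsupp.linearCombination ℝ fun j ↦ -2 * Real.cos (Real.pi / M i j)

theorem simpleCoroot_single (M : CoxeterMatrix I) (i j : I) :
    simpleCoroot M i (Finsupp.single j 1) = -2 * Real.cos (Real.pi / M i j) := by
  simp [simpleCoroot]

theorem simpleCoroot_single_self (M : CoxeterMatrix I) (i : I) :
    simpleCoroot M i (Finsupp.single i 1) = 2 := by
  simp [simpleCoroot_single]

theorem isLiftable_reflection (M : CoxeterMatrix I) :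
    M.IsLiftable fun i ↦ Module.reflection (simpleCoroot_single_self M i) := by
  intro i j
  rcases eq_or_ne i j with rfl | hij
  · ext1 z
    simp [Module.involutive_reflection _ z]
  · exact reflection_mul_reflection_pow_eq_one _ _ (M.off_diagonal i j hij)
      (simpleCoroot_single M i j) (by rw [simpleCoroot_single, M.symmetric])

/-- The geometric representation of a Coxeter group. -/
noncomputable def geometricRep (cs : CoxeterSystem M W) : W →* ((I →₀ ℝ) ≃ₗ[ℝ] (I →₀ ℝ)) :=
  cs.lift ⟨_, isLiftable_reflection M⟩

theorem geometricRep_simple (cs : CoxeterSystem M W) (i : I) (v : I →₀ ℝ) :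
    geometricRep cs (cs.simple i) v = v - simpleCoroot M i v • Finsupp.single i 1 := by
  rw [geometricRep, cs.lift_apply_simple, Module.reflection_apply]

/-- The elements of `W_J` preserve the coordinates of index outside `J`. -/
theorem geometricRep_apply_of_mem_parabolic (cs : CoxeterSystem M W) {J : Set I} {w : W}
    (hw : w ∈ parabolic cs J) {i : I} (hi : i ∉ J) (v : I →₀ ℝ) :
    geometricRep cs w v i = v i := by
  induction hw using Subgroup.closure_induction generalizing v with
  | mem x hx =>
    obtain ⟨j, hj, rfl⟩ := hx
    have hji : j ≠ i := fun h ↦ hi (h ▸ hj)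
    simp [geometricRep_simple, hji.symm]
  | one => simp
  | mul x y _ _ hx hy => rw [map_mul, LinearEquiv.mul_apply, hx, hy]
  | inv x _ hx => rw [← hx, ← LinearEquiv.mul_apply, ← map_mul, mul_inv_cancel, map_one]; rfl

/-- if `i ∉ supp(w)` and `w s_i w⁻¹ = s_k`, then `k = i` and `w`
commutes with `s_i`. -/
theorem conj_simple_outside_support
    [Fintype I] [Finite W]
    (cs : CoxeterSystem M W) (w : W) (i k : I) (hi : i ∉ supp cs w)
    (h : w * cs.simple i * w⁻¹ = cs.simple k) :
    k = i ∧ w * cs.simple i = cs.simple i * w := by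
  have hk : k = i := by
    simp only [supp, Set.mem_sInter, Set.mem_ofPred_eq, not_forall] at hi
    obtain ⟨J, hw, hiJ⟩ := hi
    set v := geometricRep cs w (Finsupp.single i 1) with hv
    have hvi : v i = 1 := by simp [hv, geometricRep_apply_of_mem_parabolic cs hw hiJ]
    have hneg : geometricRep cs (cs.simple k) v = -v := by
      rw [hv, ← LinearEquiv.mul_apply, ← map_mul, ← h, inv_mul_cancel_right, map_mul,
        LinearEquiv.mul_apply, geometricRep_simple, simpleCoroot_single_self, ← map_neg]
      congr 1
      module
    by_contra hki
    have := DFunLike.congr_fun hneg i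
    simp [geometricRep_simple, Ne.symm hki, hvi] at this
    norm_num at this
  subst hk
  exact ⟨rfl, mul_inv_eq_iff_eq_mul.mp h⟩

end HePaper
end
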